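/- arXiv:2004.10882 — 3 statements merged into one kernel-verified Lean document; each statement's English description precedes it below -/
import Mathlib

section
/- For any two disjoint finite sets T₁, T₂ of positive real numbers, there exist a probability measure P on ℝ × Bool (finitely supported) and two classifiers c₁, c₂ : ℝ → Bool such that both classifiers have perfect accuracy, i.e. R_{c₁}(0) = R_{c₂}(0) = 0, and moreover R_{c₁}(t) < R_{c₂}(t) for every t ∈ T₁ and R_{c₁}(t) > R_{c₂}(t) for every t ∈ T₂, where R_c denotes the robustness curve of c with respect to P. -/
open MeasureTheory
open scoped ENNReal

/-- The robustness curve of a classifier `c : ℝ → Bool` with respect to a measure `P`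
on `ℝ × Bool`: `R_c(ε) = P {(x, y) | ∃ x', |x - x'| ≤ ε ∧ c x' ≠ y}`. -/
noncomputable def robCurve (P : Measure (ℝ × Bool)) (c : ℝ → Bool) (ε : ℝ) : ℝ≥0∞ :=
  P {z : ℝ × Bool | ∃ x' : ℝ, |z.1 - x'| ≤ ε ∧ c x' ≠ z.2}

/-- Counting the smaller elements of a finite set gives exponents for weights that are
superincreasing. -/
theorem exists_superincreasing_weight (S : Finset ℝ) :
    ∃ w : ℝ → ℕ, ∀ t ∈ S, ∑ s ∈ S with s < t, w s < w t := by
  have hlt : ∀ s ∈ S, ∀ t, s < t → (S.filter (· < s)).card < (S.filter (· < t)).card := by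
    intro s hs t hst
    refine Finset.card_lt_card ((Finset.ssubset_iff_of_subset ?_).2 ⟨s, ?_, ?_⟩)
    · intro x hx
      rw [Finset.mem_filter] at hx ⊢
      exact ⟨hx.1, hx.2.trans hst⟩
    · simp [hs, hst]
    · simp
  refine ⟨fun t => 2 ^ (S.filter (· < t)).card, fun t _ => ?_⟩
  have hinj : Set.InjOn (fun s => (S.filter (· < s)).card) (S.filter (· < t) : Finset ℝ) := by
    intro a ha b hb hab
    simp only [Finset.coe_filter, Set.mem_ofPred_eq] at ha hb
    rcases lt_trichotomy a b with h | h | h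
    · exact absurd hab (hlt a ha.1 b h).ne
    · exact h
    · exact absurd hab (hlt b hb.1 a h).ne'
  rw [← Finset.sum_image (f := fun k => 2 ^ k) hinj]
  refine Nat.geomSum_lt le_rfl fun k hk => ?_
  obtain ⟨s, hs, rfl⟩ := Finset.mem_image.1 hk
  rw [Finset.mem_filter] at hs
  exact hlt s hs.1 t hs.2

/-- With superincreasing weights, the part of a disjoint union containing `t` has the larger
weight up to `t`. -/
theorem sum_filter_le_lt_of_superincreasing {A B S : Finset ℝ} {w : ℝ → ℕ}
    (hw : ∀ t ∈ S, ∑ s ∈ S with s < t, w s < w t) (hA : A ⊆ S) (hB : B ⊆ S)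
    (hAB : Disjoint A B) {t : ℝ} (ht : t ∈ B) :
    ∑ s ∈ A with s ≤ t, w s < ∑ s ∈ B with s ≤ t, w s := by
  calc ∑ s ∈ A with s ≤ t, w s ≤ ∑ s ∈ S with s < t, w s := by
        refine Finset.sum_le_sum_of_subset fun x hx => ?_
        rw [Finset.mem_filter] at hx ⊢
        refine ⟨hA hx.1, lt_of_le_of_ne hx.2 ?_⟩
        rintro rfl
        exact Finset.disjoint_left.1 hAB hx.1 ht
    _ < w t := hw t (hB ht)
    _ ≤ ∑ s ∈ B with s ≤ t, w s :=
        Finset.single_le_sum (f := w) (fun _ _ => Nat.zero_le _) (by simp [ht])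

/-- The robustness curve of a classifier that errs only at `a`, for a discrete measure all of
whose atoms are labelled `true`. -/
theorem robCurve_sum_dirac (C : ℝ≥0∞) (S : Finset ℝ) (w : ℝ → ℕ) (p : ℝ → ℝ) (a ε : ℝ) :
    robCurve (C • ∑ s ∈ S, (w s : ℝ≥0∞) • Measure.dirac (p s, true))
      (fun x => decide (x ≠ a)) ε =
      C * ((∑ s ∈ S with |p s - a| ≤ ε, w s : ℕ) : ℝ≥0∞) := by
  rw [robCurve, Measure.smul_apply, Measure.finsetSum_apply, smul_eq_mul, Nat.cast_sum,
    Finset.sum_filter]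
  congr 1
  refine Finset.sum_congr rfl fun s _ => ?_
  rw [Measure.smul_apply, Measure.dirac_apply]
  by_cases h : |p s - a| ≤ ε <;> simp [Set.indicator, h]

theorem exists_robCurve_lt_of_nonempty (T₁ T₂ : Finset ℝ) (hT₁ : ∀ t ∈ T₁, 0 < t)
    (hT₂ : ∀ t ∈ T₂, 0 < t) (hdisj : Disjoint T₁ T₂) (hne : (T₁ ∪ T₂).Nonempty) :
    ∃ (P : Measure (ℝ × Bool)) (c₁ c₂ : ℝ → Bool),
      IsProbabilityMeasure P ∧
      (∃ s : Finset (ℝ × Bool), P ((↑s : Set (ℝ × Bool))ᶜ) = 0) ∧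
      robCurve P c₁ 0 = 0 ∧ robCurve P c₂ 0 = 0 ∧
      (∀ t ∈ T₁, robCurve P c₁ t < robCurve P c₂ t) ∧
      (∀ t ∈ T₂, robCurve P c₂ t < robCurve P c₁ t) := by
  classical
  obtain ⟨w, hw⟩ := exists_superincreasing_weight (T₁ ∪ T₂)
  obtain ⟨M, hM⟩ := (T₁ ∪ T₂).bddAbove
  have hpos : ∀ t ∈ T₁ ∪ T₂, 0 < t := fun t ht =>
    (Finset.mem_union.1 ht).elim (hT₁ t) (hT₂ t)
  have hle : ∀ t ∈ T₁ ∪ T₂, t ≤ M := fun t ht => hM (Finset.mem_coe.2 ht)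
  have hMpos : 0 < M := hne.elim fun t ht => (hpos t ht).trans_le (hle t ht)
  let p : ℝ → ℝ := fun t => if t ∈ T₁ then M + t else -t
  have hp₁ : ∀ ε ≤ M, (T₁ ∪ T₂).filter (fun s => |p s - 0| ≤ ε) = T₂.filter (· ≤ ε) := by
    intro ε hε
    ext s
    simp only [Finset.mem_filter, p]
    by_cases h : s ∈ T₁
    · have h0 := hT₁ s h
      have h2 : s ∉ T₂ := Finset.disjoint_left.1 hdisj h
      simp only [h, h2, if_true, sub_zero, false_and, iff_false, not_and, not_le]
      intro _
      rw [abs_of_pos (by linarith)]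
      linarith
    · simp only [h, Finset.mem_union, false_or, if_false, sub_zero, abs_neg]
      refine and_congr_right fun h2 => ?_
      rw [abs_of_pos (hT₂ s h2)]
  have hp₂ : ∀ ε ≤ M, (T₁ ∪ T₂).filter (fun s => |p s - M| ≤ ε) = T₁.filter (· ≤ ε) := by
    intro ε hε
    ext s
    simp only [Finset.mem_filter, p]
    by_cases h : s ∈ T₁
    · simp [h, abs_of_pos (hT₁ s h)]
    · simp only [h, Finset.mem_union, false_or, if_false, false_and, iff_false, not_and, not_le]
      intro h2
      have h0 := hT₂ s h2
      rw [abs_of_neg (by linarith)]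
      linarith
  have hzero : ∀ A : Finset ℝ, (∀ t ∈ A, 0 < t) → A.filter (· ≤ 0) = ∅ := fun A hA =>
    Finset.filter_eq_empty_iff.2 fun t ht => not_le.2 (hA t ht)
  set W : ℕ := ∑ s ∈ T₁ ∪ T₂, w s with hW
  have hWpos : W ≠ 0 := by
    obtain ⟨t, ht⟩ := hne
    have := Finset.single_le_sum (f := w) (fun _ _ => Nat.zero_le _) ht
    have := hw t ht
    lia
  have hC0 : (W : ℝ≥0∞)⁻¹ ≠ 0 := ENNReal.inv_ne_zero.2 (ENNReal.natCast_ne_top W)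
  have hCtop : (W : ℝ≥0∞)⁻¹ ≠ ⊤ := ENNReal.inv_ne_top.2 (Nat.cast_ne_zero.2 hWpos)
  refine ⟨(W : ℝ≥0∞)⁻¹ • ∑ s ∈ T₁ ∪ T₂, (w s : ℝ≥0∞) • Measure.dirac (p s, true),
    fun x => decide (x ≠ 0), fun x => decide (x ≠ M), ⟨?_⟩,
    ⟨(T₁ ∪ T₂).image fun s => (p s, true), ?_⟩, ?_, ?_, fun t ht => ?_, fun t ht => ?_⟩
  · simp only [Measure.smul_apply, Measure.finsetSum_apply, measure_univ, smul_eq_mul, mul_one]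
    rw [← Nat.cast_sum, ← hW]
    exact ENNReal.inv_mul_cancel (Nat.cast_ne_zero.2 hWpos) (ENNReal.natCast_ne_top W)
  · rw [Measure.smul_apply, Measure.finsetSum_apply, Finset.sum_eq_zero, smul_zero]
    intro s hs
    rw [Measure.smul_apply, Measure.dirac_apply, Set.indicator_of_notMem, smul_zero]
    exact fun h => h (Finset.mem_coe.2 (Finset.mem_image_of_mem _ hs))
  · rw [robCurve_sum_dirac, hp₁ 0 hMpos.le, hzero T₂ hT₂]
    simp
  · rw [robCurve_sum_dirac, hp₂ 0 hMpos.le, hzero T₁ hT₁]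
    simp
  · have htM := hle t (Finset.mem_union_left _ ht)
    rw [robCurve_sum_dirac, robCurve_sum_dirac, hp₁ t htM, hp₂ t htM]
    exact (ENNReal.mul_lt_mul_iff_right hC0 hCtop).2 (Nat.cast_lt.2
      (sum_filter_le_lt_of_superincreasing hw Finset.subset_union_right
        Finset.subset_union_left hdisj.symm ht))
  · have htM := hle t (Finset.mem_union_right _ ht)
    rw [robCurve_sum_dirac, robCurve_sum_dirac, hp₁ t htM, hp₂ t htM]
    exact (ENNReal.mul_lt_mul_iff_right hC0 hCtop).2 (Nat.cast_lt.2
      (sum_filter_le_lt_of_superincreasing hw Finset.subset_union_left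
        Finset.subset_union_right hdisj ht))

/-- For any two disjoint finite sets `T₁, T₂` of positive reals, there exist a finitely
supported probability measure `P` on `ℝ × Bool` and classifiers `c₁, c₂ : ℝ → Bool`,
both with perfect accuracy (`R_{c₁}(0) = R_{c₂}(0) = 0`), such that the robustness curve
of `c₁` is strictly below that of `c₂` on `T₁` and strictly above it on `T₂`. -/
theorem robustness_curves_arbitrary_intersections_perfect_accuracy
    (T₁ T₂ : Finset ℝ) (hT₁ : ∀ t ∈ T₁, 0 < t) (hT₂ : ∀ t ∈ T₂, 0 < t)
    (hdisj : Disjoint T₁ T₂) :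
    ∃ (P : Measure (ℝ × Bool)) (c₁ c₂ : ℝ → Bool),
      IsProbabilityMeasure P ∧
      (∃ s : Finset (ℝ × Bool), P ((↑s : Set (ℝ × Bool))ᶜ) = 0) ∧
      robCurve P c₁ 0 = 0 ∧ robCurve P c₂ 0 = 0 ∧
      (∀ t ∈ T₁, robCurve P c₁ t < robCurve P c₂ t) ∧
      (∀ t ∈ T₂, robCurve P c₂ t < robCurve P c₁ t) := by
  rcases (T₁ ∪ T₂).eq_empty_or_nonempty with h | h
  · obtain ⟨rfl, rfl⟩ := Finset.union_eq_empty.1 h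
    obtain ⟨P, c₁, c₂, hP, hs, h₁, h₂, -, -⟩ :=
      exists_robCurve_lt_of_nonempty ∅ {1} (by simp) (by simp) (by simp) (by simp)
    exact ⟨P, c₁, c₂, hP, hs, h₁, h₂, by simp, by simp⟩
  · exact exists_robCurve_lt_of_nonempty T₁ T₂ hT₁ hT₂ hdisj h
end

section
/- Let w ∈ ℝ^m with w ≠ 0 and b ∈ ℝ, and let f(x) = sign(⟨w, x⟩ + b) be the associated linear classifier. Let P be a probability measure on ℝ^m × ℝ, and for p ∈ [1, ∞] let R_p(ε) = P({(x, y) : ∃ x', ‖x − x'‖_p ≤ ε and sign(⟨w, x'⟩ + b) ≠ y}) be the ℓ_p robustness curve of f. Then for all p₁, p₂ ∈ [1, ∞] with Hölder conjugates q₁, q₂ and all ε ≥ 0, R_{p₁}(ε) = R_{p₂}(c · ε) where c = ‖w‖_{q₁} / ‖w‖_{q₂}. In particular, the shape of the robustness curve of a linear classifier does not depend on the choice of ℓ_p norm. -/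
open MeasureTheory
open scoped ENNReal

/-- The `ℓ_p` norm of a vector in `ℝ^m`. -/
noncomputable def lpNorm {m : ℕ} (p : ℝ≥0∞) [Fact (1 ≤ p)] (v : Fin m → ℝ) : ℝ :=
  ‖(WithLp.equiv p (Fin m → ℝ)).symm v‖

/-- The `ℓ_p` robustness curve of a classifier `f : ℝ^m → ℝ` with respect to a measure `P`
on `ℝ^m × ℝ`: `R_p(ε) = P {(x, y) | ∃ x', ‖x - x'‖_p ≤ ε ∧ f x' ≠ y}`. -/
noncomputable def robCurveLp {m : ℕ} (P : Measure ((Fin m → ℝ) × ℝ))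
    (p : ℝ≥0∞) [Fact (1 ≤ p)] (f : (Fin m → ℝ) → ℝ) (ε : ℝ) : ℝ≥0∞ :=
  P {z : (Fin m → ℝ) × ℝ | ∃ x' : Fin m → ℝ, lpNorm p (z.1 - x') ≤ ε ∧ f x' ≠ z.2}

lemma lpNorm_neg {m : ℕ} (p : ℝ≥0∞) [Fact (1 ≤ p)] (v : Fin m → ℝ) :
    lpNorm p (-v) = lpNorm p v := by
  simp [_root_.lpNorm]

lemma lpNorm_smul {m : ℕ} (p : ℝ≥0∞) [Fact (1 ≤ p)] (c : ℝ) (v : Fin m → ℝ) :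
    lpNorm p (c • v) = |c| * lpNorm p v := by
  simp [_root_.lpNorm, norm_smul]

lemma lpNorm_pos {m : ℕ} (p : ℝ≥0∞) [Fact (1 ≤ p)] {v : Fin m → ℝ} (hv : v ≠ 0) :
    0 < lpNorm p v := by
  simpa [_root_.lpNorm] using hv

lemma abs_apply_le_lpNorm {m : ℕ} (p : ℝ≥0∞) [Fact (1 ≤ p)] (v : Fin m → ℝ) (i : Fin m) :
    |v i| ≤ lpNorm p v := by
  simpa [_root_.lpNorm] using PiLp.norm_apply_le (WithLp.toLp p v) i

lemma lpNorm_one {m : ℕ} (v : Fin m → ℝ) : lpNorm 1 v = ∑ i, |v i| := by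
  simp [_root_.lpNorm, PiLp.norm_eq_of_L1]

lemma lpNorm_top {m : ℕ} (v : Fin m → ℝ) : lpNorm ∞ v = ⨆ i, |v i| := by
  simp [_root_.lpNorm, PiLp.norm_eq_ciSup, -PiLp.norm_toLp]

lemma lpNorm_eq_sum {m : ℕ} {p : ℝ≥0∞} [Fact (1 ≤ p)] (hp : 0 < p.toReal) (v : Fin m → ℝ) :
    lpNorm p v = (∑ i, |v i| ^ p.toReal) ^ (1 / p.toReal) := by
  simp [_root_.lpNorm, PiLp.norm_eq_sum hp]

/-- **Hölder's inequality** for the norms `lpNorm`. -/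
lemma sum_mul_le_lpNorm_mul_lpNorm {m : ℕ} (p q : ℝ≥0∞) [Fact (1 ≤ p)] [Fact (1 ≤ q)]
    [hpq : p.HolderConjugate q] (w v : Fin m → ℝ) :
    ∑ i, w i * v i ≤ lpNorm q w * lpNorm p v := by
  by_cases hp : p = ∞
  · obtain rfl : q = 1 := (ENNReal.HolderConjugate.eq_top_iff_eq_one p q).1 hp
    rw [lpNorm_one, Finset.sum_mul]
    refine Finset.sum_le_sum fun i _ => (le_abs_self _).trans ?_
    rw [abs_mul]
    exact mul_le_mul_of_nonneg_left (abs_apply_le_lpNorm p v i) (abs_nonneg _)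
  by_cases hq : q = ∞
  · obtain rfl : p = 1 := (ENNReal.HolderConjugate.eq_top_iff_eq_one q p).1 hq
    rw [lpNorm_one, Finset.mul_sum]
    refine Finset.sum_le_sum fun i _ => (le_abs_self _).trans ?_
    rw [abs_mul]
    exact mul_le_mul_of_nonneg_right (abs_apply_le_lpNorm q w i) (abs_nonneg _)
  have h := (ENNReal.HolderConjugate.toReal_of_ne_top hp hq).symm
  rw [lpNorm_eq_sum h.pos, lpNorm_eq_sum h.symm.pos]
  exact Real.inner_le_Lp_mul_Lq _ w v h

/-- Hölder's inequality is sharp: the dual norm of a nonzero vector is attained on the unit ball. -/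
lemma exists_lpNorm_le_one_sum_mul_eq {m : ℕ} (p q : ℝ≥0∞) [Fact (1 ≤ p)] [Fact (1 ≤ q)]
    [hpq : p.HolderConjugate q] {w : Fin m → ℝ} (hw : w ≠ 0) :
    ∃ v : Fin m → ℝ, lpNorm p v ≤ 1 ∧ ∑ i, w i * v i = lpNorm q w := by
  have abs_sign_le (a : ℝ) : |(SignType.sign a : ℝ)| ≤ 1 := by
    rcases lt_trichotomy a 0 with h | h | h <;> simp [h]
  obtain ⟨j, -⟩ := Function.ne_iff.1 hw
  have : Nonempty (Fin m) := ⟨j⟩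
  by_cases hp : p = ∞
  · obtain rfl : q = 1 := (ENNReal.HolderConjugate.eq_top_iff_eq_one p q).1 hp
    subst hp
    refine ⟨fun i => SignType.sign (w i), ?_, ?_⟩
    · rw [lpNorm_top]
      exact ciSup_le fun i => abs_sign_le _
    · simp [lpNorm_one]
  by_cases hq : q = ∞
  · obtain rfl : p = 1 := (ENNReal.HolderConjugate.eq_top_iff_eq_one q p).1 hq
    subst hq
    obtain ⟨i, hi⟩ := exists_eq_ciSup_of_finite (f := fun i => |w i|)
    refine ⟨Pi.single i (SignType.sign (w i) : ℝ), ?_, ?_⟩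
    · rw [lpNorm_one, Finset.sum_eq_single i (by simp +contextual) (by simp)]
      simpa using abs_sign_le (w i)
    · rw [lpNorm_top, ← hi,
        Finset.sum_eq_single i (by simp +contextual) (by simp)]
      simp
  have h := (ENNReal.HolderConjugate.toReal_of_ne_top hp hq).symm
  obtain ⟨g, hg, hgw⟩ :=
    (NNReal.isGreatest_Lp Finset.univ (fun i => Real.nnabs (w i)) h).1
  refine ⟨fun i => SignType.sign (w i) * g i, ?_, ?_⟩
  · rw [lpNorm_eq_sum h.symm.pos]
    refine Real.rpow_le_one (by positivity) ?_ (by have := h.symm.pos; positivity)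
    refine le_trans (Finset.sum_le_sum fun i _ => ?_)
      (by exact_mod_cast hg : ∑ i, (g i : ℝ) ^ p.toReal ≤ 1)
    refine Real.rpow_le_rpow (abs_nonneg _) ?_ h.symm.nonneg
    rw [abs_mul, NNReal.abs_eq]
    exact mul_le_of_le_one_left (g i).2 (abs_sign_le _)
  · rw [lpNorm_eq_sum h.pos]
    have := congrArg ((↑) : NNReal → ℝ) hgw
    push_cast at this
    simpa [← mul_assoc] using this

/-- The image of an `ℓ_p` ball of radius `ε` under an affine functional with nonzero linear part
`w` is the interval of radius `ε * ‖w‖_q` around the image of the center. -/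
lemma exists_lpNorm_sub_le_iff {m : ℕ} (p q : ℝ≥0∞) [Fact (1 ≤ p)] [Fact (1 ≤ q)]
    [hpq : p.HolderConjugate q] {w : Fin m → ℝ} (hw : w ≠ 0) (b ε : ℝ) (x : Fin m → ℝ)
    (S : ℝ → Prop) :
    (∃ x' : Fin m → ℝ, lpNorm p (x - x') ≤ ε ∧ S (∑ i, w i * x' i + b)) ↔
      ∃ s, |∑ i, w i * x i + b - s| ≤ ε * lpNorm q w ∧ S s := by
  have hN := lpNorm_pos q hw
  constructor
  · rintro ⟨x', hx, hS⟩
    refine ⟨_, ?_, hS⟩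
    have hle := sum_mul_le_lpNorm_mul_lpNorm p q w (x - x')
    have hge := sum_mul_le_lpNorm_mul_lpNorm p q w (-(x - x'))
    rw [lpNorm_neg] at hge
    have hmul := mul_le_mul_of_nonneg_left hx hN.le
    simp only [Pi.neg_apply, Pi.sub_apply, mul_neg, Finset.sum_neg_distrib, mul_sub,
      Finset.sum_sub_distrib] at hle hge
    rw [abs_le]
    constructor <;> linarith
  · rintro ⟨s, hs, hS⟩
    obtain ⟨v, hv, hvw⟩ := exists_lpNorm_le_one_sum_mul_eq p q hw
    set t := ∑ i, w i * x i + b with ht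
    refine ⟨x - ((t - s) / lpNorm q w) • v, ?_, ?_⟩
    · rw [sub_sub_cancel, lpNorm_smul, abs_div, abs_of_pos hN]
      exact (mul_le_of_le_one_right (by positivity) hv).trans ((div_le_iff₀ hN).2 hs)
    · convert hS
      have : ∑ i, w i * (x - ((t - s) / lpNorm q w) • v) i
          = ∑ i, w i * x i - (t - s) / lpNorm q w * ∑ i, w i * v i := by
        simp only [Pi.sub_apply, Pi.smul_apply, smul_eq_mul, mul_sub, Finset.sum_sub_distrib,
          Finset.mul_sum, mul_left_comm]
      rw [this, hvw, div_mul_cancel₀ _ hN.ne']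
      linarith

/-- The shape of the robustness curve of a linear classifier `x ↦ sign(⟨w, x⟩ + b)` does
not depend on the choice of `ℓ_p` norm: for `p₁, p₂ ∈ [1, ∞]` with Hölder conjugates
`q₁, q₂`, the `ℓ_{p₁}` robustness curve at `ε` equals the `ℓ_{p₂}` robustness curve at
`(‖w‖_{q₁} / ‖w‖_{q₂}) · ε`. -/
theorem linear_classifier_robustness_curve_shape {m : ℕ}
    (w : Fin m → ℝ) (hw : w ≠ 0) (b : ℝ)
    (P : Measure ((Fin m → ℝ) × ℝ)) (hP : IsProbabilityMeasure P)
    (p₁ q₁ p₂ q₂ : ℝ≥0∞) [Fact (1 ≤ p₁)] [Fact (1 ≤ q₁)] [Fact (1 ≤ p₂)] [Fact (1 ≤ q₂)]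
    (h₁ : p₁⁻¹ + q₁⁻¹ = 1) (h₂ : p₂⁻¹ + q₂⁻¹ = 1)
    (ε : ℝ) (hε : 0 ≤ ε) :
    robCurveLp P p₁ (fun x => Real.sign (∑ i, w i * x i + b)) ε
      = robCurveLp P p₂ (fun x => Real.sign (∑ i, w i * x i + b))
          ((lpNorm q₁ w / lpNorm q₂ w) * ε) := by
  have := ENNReal.holderConjugate_iff.2 h₁
  have := ENNReal.holderConjugate_iff.2 h₂
  have hN := lpNorm_pos q₂ hw
  unfold robCurveLp
  congr 1
  ext z
  simp only [Set.mem_ofPred_eq]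
  rw [exists_lpNorm_sub_le_iff p₁ q₁ hw b ε z.1 (fun s => Real.sign s ≠ z.2),
    exists_lpNorm_sub_le_iff p₂ q₂ hw b _ z.1 (fun s => Real.sign s ≠ z.2),
    mul_right_comm, div_mul_cancel₀ _ hN.ne', mul_comm ε]
end

section
/- There exist a finitely supported probability measure P on ℝ² × ℝ, two linear classifiers f₁(x) = sign(⟨w₁, x⟩ + b₁) and f₂(x) = sign(⟨w₂, x⟩ + b₂) with w₁, w₂ ≠ 0, and thresholds ε₁, ε₂ > 0 such that the ℓ₂ robustness curves of the two classifiers intersect, i.e. R²_{f₁}(ε₁) < R²_{f₂}(ε₁) and R²_{f₁}(ε₂) > R²_{f₂}(ε₂), while their ℓ_∞ robustness curves do not intersect, i.e. R^∞_{f₁}(ε) ≤ R^∞_{f₂}(ε) for all ε ≥ 0. In other words, robustness curve intersections for linear classifiers do not transfer between distances induced by different ℓ_p norms. -/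
open MeasureTheory
open scoped ENNReal

theorem lpNorm_two_le_iff (v : Fin 2 → ℝ) {ε : ℝ} (hε : 0 ≤ ε) :
    lpNorm 2 v ≤ ε ↔ v 0 ^ 2 + v 1 ^ 2 ≤ ε ^ 2 := by
  unfold _root_.lpNorm
  rw [EuclideanSpace.norm_eq, Real.sqrt_le_left hε]
  simp [Fin.sum_univ_two]

theorem lpNorm_top_le_iff (v : Fin 2 → ℝ) {ε : ℝ} (hε : 0 ≤ ε) :
    lpNorm ⊤ v ≤ ε ↔ |v 0| ≤ ε ∧ |v 1| ≤ ε := by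
  unfold _root_.lpNorm
  rw [WithLp.equiv_symm_apply, PiLp.norm_toLp, pi_norm_le_iff_of_nonneg hε]
  simp [Fin.forall_fin_two]

theorem Real.sign_ne_one_iff {t : ℝ} : Real.sign t ≠ 1 ↔ t ≤ 0 := by
  rcases lt_trichotomy t 0 with h | rfl | h
  · simp [Real.sign_of_neg h, h.le]; norm_num
  · simp
  · simp [Real.sign_of_pos h, h]

/-- The uniform probability measure on the points `(2, 0)` and `(5, 5)`, both labelled `1`. -/
noncomputable def twoPointMeasure : Measure ((Fin 2 → ℝ) × ℝ) :=
  (2⁻¹ : ℝ≥0∞) • Measure.dirac (![2, 0], 1) + (2⁻¹ : ℝ≥0∞) • Measure.dirac (![5, 5], 1)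

theorem twoPointMeasure_apply (s : Set ((Fin 2 → ℝ) × ℝ)) :
    twoPointMeasure s =
      2⁻¹ * s.indicator 1 (![2, 0], 1) + 2⁻¹ * s.indicator 1 (![5, 5], 1) := by
  simp [twoPointMeasure, Measure.dirac_apply]

theorem twoPointMeasure_le {s t : Set ((Fin 2 → ℝ) × ℝ)}
    (hA : (![2, 0], 1) ∈ s → (![2, 0], 1) ∈ t) (hB : (![5, 5], 1) ∈ s → (![5, 5], 1) ∈ t) :
    twoPointMeasure s ≤ twoPointMeasure t := by
  classical
  simp only [twoPointMeasure_apply, Set.indicator_apply, Pi.one_apply]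
  gcongr <;> split_ifs <;> simp_all

/-- Robustness curve intersections for linear classifiers do not transfer between
distances induced by different `ℓ_p` norms: there exist a finitely supported probability
measure `P` on `ℝ² × ℝ`, two linear classifiers `f₁, f₂`, and thresholds `ε₁, ε₂ > 0`
such that the `ℓ₂` robustness curves of `f₁` and `f₂` intersect, while the `ℓ_∞`
robustness curve of `f₁` never exceeds that of `f₂`. -/
theorem robustness_curve_intersections_do_not_transfer :
    ∃ (P : Measure ((Fin 2 → ℝ) × ℝ)) (w₁ w₂ : Fin 2 → ℝ) (b₁ b₂ : ℝ) (ε₁ ε₂ : ℝ),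
      IsProbabilityMeasure P ∧
      (∃ s : Finset ((Fin 2 → ℝ) × ℝ), P ((↑s : Set ((Fin 2 → ℝ) × ℝ))ᶜ) = 0) ∧
      w₁ ≠ 0 ∧ w₂ ≠ 0 ∧ 0 < ε₁ ∧ 0 < ε₂ ∧
      robCurveLp P 2 (fun x => Real.sign (∑ i, w₁ i * x i + b₁)) ε₁
        < robCurveLp P 2 (fun x => Real.sign (∑ i, w₂ i * x i + b₂)) ε₁ ∧
      robCurveLp P 2 (fun x => Real.sign (∑ i, w₂ i * x i + b₂)) ε₂
        < robCurveLp P 2 (fun x => Real.sign (∑ i, w₁ i * x i + b₁)) ε₂ ∧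
      (∀ ε : ℝ, 0 ≤ ε →
        robCurveLp P ⊤ (fun x => Real.sign (∑ i, w₁ i * x i + b₁)) ε
          ≤ robCurveLp P ⊤ (fun x => Real.sign (∑ i, w₂ i * x i + b₂)) ε) := by
  refine ⟨twoPointMeasure, ![1, 0], ![1, 1], 0, 0, 3 / 2, 5, ⟨?_⟩,
    ⟨{(![2, 0], 1), (![5, 5], 1)}, ?_⟩, ?_, ?_, by norm_num, by norm_num, ?_, ?_, ?_⟩
  · simp [twoPointMeasure_apply, ENNReal.inv_two_add_inv_two]
  · simp [twoPointMeasure_apply]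
  · exact fun h => by simpa using congrFun h 0
  · exact fun h => by simpa using congrFun h 0
  · refine lt_of_le_of_lt (b := 0) ?_ (lt_of_lt_of_le (b := 2⁻¹) (by simp) ?_)
    · unfold robCurveLp
      rw [twoPointMeasure_apply, Set.indicator_of_notMem, Set.indicator_of_notMem]
      · simp
      all_goals
        rintro ⟨x, hx, hs⟩
        rw [lpNorm_two_le_iff _ (by norm_num)] at hx
        rw [Real.sign_ne_one_iff] at hs
        simp [Fin.sum_univ_two] at hx hs
        nlinarith [sq_nonneg (x 1), sq_nonneg (5 - x 1)]
    · unfold robCurveLp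
      rw [twoPointMeasure_apply, Set.indicator_of_mem]
      · simp
      · refine ⟨![1, -1], ?_, ?_⟩
        · rw [lpNorm_two_le_iff _ (by norm_num)]
          norm_num
        · rw [Real.sign_ne_one_iff]
          simp [Fin.sum_univ_two]
  · refine lt_of_le_of_lt (b := 2⁻¹) ?_ (lt_of_lt_of_le (b := 1) (by simp) ?_)
    · unfold robCurveLp
      rw [twoPointMeasure_apply, Set.indicator_of_notMem (a := (![5, 5], 1))]
      · rw [mul_zero, add_zero]
        exact mul_le_of_le_one_right' (Set.indicator_le_self _ _ _)
      · rintro ⟨x, hx, hs⟩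
        rw [lpNorm_two_le_iff _ (by norm_num)] at hx
        rw [Real.sign_ne_one_iff] at hs
        simp [Fin.sum_univ_two] at hx hs
        nlinarith [sq_nonneg (x 0 - x 1), sq_nonneg (x 0 + x 1)]
    · unfold robCurveLp
      rw [twoPointMeasure_apply, Set.indicator_of_mem, Set.indicator_of_mem]
      · simp [ENNReal.inv_two_add_inv_two]
      · refine ⟨![0, 5], ?_, ?_⟩
        · rw [lpNorm_two_le_iff _ (by norm_num)]
          norm_num
        · rw [Real.sign_ne_one_iff]
          simp [Fin.sum_univ_two]
      · refine ⟨![0, 0], ?_, ?_⟩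
        · rw [lpNorm_two_le_iff _ (by norm_num)]
          norm_num
        · rw [Real.sign_ne_one_iff]
          simp [Fin.sum_univ_two]
  · intro ε hε
    refine twoPointMeasure_le ?_ ?_
    · rintro ⟨x, hx, hs⟩
      rw [lpNorm_top_le_iff _ hε] at hx
      rw [Real.sign_ne_one_iff] at hs
      simp [Fin.sum_univ_two] at hx hs
      have h := (le_abs_self _).trans hx.1
      refine ⟨![1, -1], ?_, ?_⟩
      · rw [lpNorm_top_le_iff _ hε]
        norm_num
        linarith
      · rw [Real.sign_ne_one_iff]
        simp [Fin.sum_univ_two]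
    · rintro ⟨x, hx, hs⟩
      rw [lpNorm_top_le_iff _ hε] at hx
      rw [Real.sign_ne_one_iff] at hs
      simp [Fin.sum_univ_two] at hx hs
      have h := (le_abs_self _).trans hx.1
      refine ⟨![0, 0], ?_, ?_⟩
      · rw [lpNorm_top_le_iff _ hε]
        norm_num
        linarith
      · rw [Real.sign_ne_one_iff]
        simp [Fin.sum_univ_two]
end
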